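/- The set P of all ∞-proofs of Go_∞+cut equipped with the distance d_P(π,τ) = inf{2⁻ⁿ : π ∼ₙ τ} is a spherically complete ultrametric space (in particular, it is a complete metric space satisfying the strong triangle inequality). -/

import Mathlib

inductive Formula : Type
  | atom : ℕ → Formula
  | bot  : Formula
  | imp  : Formula → Formula → Formula
  | box  : Formula → Formula
deriving DecidableEq

def boxtimes (Γ : Multiset Formula) : Multiset Formula := Γ + Γ.map Formula.box

inductive GoSeq : Bool → Multiset Formula → Multiset Formula → Prop
  | ax (c) (Γ Δ : Multiset Formula) (A : Formula) : GoSeq c (A ::ₘ Γ) (A ::ₘ Δ)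
  | axBot (c) (Γ Δ : Multiset Formula) : GoSeq c (Formula.bot ::ₘ Γ) Δ
  | impL (c) (Γ Δ : Multiset Formula) (A B : Formula) :
      GoSeq c (B ::ₘ Γ) Δ → GoSeq c Γ (A ::ₘ Δ) → GoSeq c ((A.imp B) ::ₘ Γ) Δ
  | impR (c) (Γ Δ : Multiset Formula) (A B : Formula) :
      GoSeq c (A ::ₘ Γ) (B ::ₘ Δ) → GoSeq c Γ ((A.imp B) ::ₘ Δ)
  | boxGo (c) (Γ Δ Θ : Multiset Formula) (A : Formula) :
      GoSeq c ((Formula.box (A.imp (Formula.box A))) ::ₘ boxtimes Θ) {A} →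
      GoSeq c (Γ + Θ.map Formula.box) ((Formula.box A) ::ₘ Δ)
  | cut (Γ Δ : Multiset Formula) (A : Formula) :
      GoSeq true Γ (A ::ₘ Δ) → GoSeq true (A ::ₘ Γ) Δ → GoSeq true Γ Δ

inductive Frag : Bool → ℕ → Multiset Formula → Multiset Formula → Type
  | hole (c) (Γ Δ : Multiset Formula) : Frag c 0 Γ Δ
  | axP (c) (n) (Γ Δ : Multiset Formula) (p : ℕ) :
      Frag c (n+1) (Formula.atom p ::ₘ Γ) (Formula.atom p ::ₘ Δ)
  | axBot (c) (n) (Γ Δ : Multiset Formula) : Frag c (n+1) (Formula.bot ::ₘ Γ) Δ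
  | impL (c) (n) (Γ Δ : Multiset Formula) (A B : Formula) :
      Frag c (n+1) (B ::ₘ Γ) Δ → Frag c (n+1) Γ (A ::ₘ Δ) →
      Frag c (n+1) ((A.imp B) ::ₘ Γ) Δ
  | impR (c) (n) (Γ Δ : Multiset Formula) (A B : Formula) :
      Frag c (n+1) (A ::ₘ Γ) (B ::ₘ Δ) → Frag c (n+1) Γ ((A.imp B) ::ₘ Δ)
  | box (c) (n) (Γ Δ Θ : Multiset Formula) (l : List Formula) (h : l ≠ []) :
      Frag c (n+1) (boxtimes Θ) (boxtimes (↑l)) →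
      ((i : Fin l.length) → Frag c n (boxtimes Θ) {l.get i}) →
      Frag c (n+1) (Γ + Θ.map Formula.box) ((↑(l.map Formula.box) : Multiset Formula) + Δ)
  | cut (n) (Γ Δ : Multiset Formula) (A : Formula) :
      Frag true (n+1) Γ (A ::ₘ Δ) → Frag true (n+1) (A ::ₘ Γ) Δ → Frag true (n+1) Γ Δ

def Frag.trunc : ∀ {c : Bool} {n : ℕ} {Γ Δ : Multiset Formula}, Frag c (n+1) Γ Δ → Frag c n Γ Δ
  | c, 0, Γ, Δ, _ => .hole c Γ Δ
  | c, n+1, _, _, .axP _ _ Γ Δ p => .axP c n Γ Δ p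
  | c, n+1, _, _, .axBot _ _ Γ Δ => .axBot c n Γ Δ
  | c, n+1, _, _, .impL _ _ Γ Δ A B a b => .impL c n Γ Δ A B a.trunc b.trunc
  | c, n+1, _, _, .impR _ _ Γ Δ A B a => .impR c n Γ Δ A B a.trunc
  | c, n+1, _, _, .box _ _ Γ Δ Θ l h a bs => .box c n Γ Δ Θ l h a.trunc (fun i => (bs i).trunc)
  | _, n+1, _, _, .cut _ Γ Δ A a b => .cut n Γ Δ A a.trunc b.trunc

def Frag.height : ∀ {c : Bool} {n : ℕ} {Γ Δ : Multiset Formula}, Frag c n Γ Δ → ℕ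
  | _, _, _, _, .hole _ _ _ => 0
  | _, _, _, _, .axP _ _ _ _ _ => 0
  | _, _, _, _, .axBot _ _ _ _ => 0
  | _, _, _, _, .impL _ _ _ _ _ _ a b => max a.height b.height + 1
  | _, _, _, _, .impR _ _ _ _ _ _ a => a.height + 1
  | _, _, _, _, .box _ _ _ _ _ _ _ a bs =>
      max a.height (Finset.univ.sup fun i => (bs i).height) + 1
  | _, _, _, _, .cut _ _ _ _ a b => max a.height b.height + 1

def Frag.cutFree : ∀ {c : Bool} {n : ℕ} {Γ Δ : Multiset Formula}, Frag c n Γ Δ → Prop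
  | _, _, _, _, .hole _ _ _ => True
  | _, _, _, _, .axP _ _ _ _ _ => True
  | _, _, _, _, .axBot _ _ _ _ => True
  | _, _, _, _, .impL _ _ _ _ _ _ a b => a.cutFree ∧ b.cutFree
  | _, _, _, _, .impR _ _ _ _ _ _ a => a.cutFree
  | _, _, _, _, .box _ _ _ _ _ _ _ a bs => a.cutFree ∧ ∀ i, (bs i).cutFree
  | _, _, _, _, .cut _ _ _ _ _ _ => False

structure InfProof (c : Bool) (Γ Δ : Multiset Formula) : Type where
  frag : ∀ n : ℕ, Frag c n Γ Δ
  compat : ∀ n : ℕ, (frag (n+1)).trunc = frag n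

structure PP : Type where
  Γ : Multiset Formula
  Δ : Multiset Formula
  prf : InfProof true Γ Δ

def Sim : ℕ → PP → PP → Prop
  | 0, _, _ => True
  | n+1, π, τ => π.Γ = τ.Γ ∧ π.Δ = τ.Δ ∧ HEq (π.prf.frag (n+1)) (τ.prf.frag (n+1))

noncomputable def dP (π τ : PP) : ℝ :=
  sInf {r : ℝ | ∃ n : ℕ, Sim n π τ ∧ r = (1/2 : ℝ) ^ n}

def localHeight (π : PP) : ℕ := (π.prf.frag 1).height

def Pmem (n : ℕ) (π : PP) : Prop := (π.prf.frag n).cutFree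

def IsUltrametric {M : Type*} (d : M → M → ℝ) : Prop :=
  (∀ x y, 0 ≤ d x y) ∧ (∀ x y, d x y = 0 ↔ x = y) ∧ (∀ x y, d x y = d y x) ∧
  (∀ x y z, d x z ≤ max (d x y) (d y z))

def cBall {M : Type*} (d : M → M → ℝ) (x : M) (r : ℝ) : Set M := {y | d x y ≤ r}

def SphericallyComplete {M : Type*} (d : M → M → ℝ) : Prop :=
  ∀ (c : ℕ → M) (r : ℕ → ℝ), (∀ n, 0 ≤ r n) →
    (∀ n, cBall d (c (n+1)) (r (n+1)) ⊆ cBall d (c n) (r n)) →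
    ∃ x, ∀ n, x ∈ cBall d (c n) (r n)

def NonExpansive1 (u : PP → PP) : Prop := ∀ π τ, dP (u π) (u τ) ≤ dP π τ

def Adequate1 (u : PP → PP) : Prop := ∀ n π, Pmem n π → Pmem n (u π)

noncomputable def dPm {m : ℕ} (x y : Fin m → PP) : ℝ := ⨆ i, dP (x i) (y i)

def NonExpansiveM {m : ℕ} (u : (Fin m → PP) → PP) : Prop :=
  ∀ x y, dP (u x) (u y) ≤ dPm x y

def Fm (m : ℕ) : Type := {u : (Fin m → PP) → PP // NonExpansiveM u}

def SimF {m : ℕ} (n k : ℕ) (a b : (Fin m → PP) → PP) : Prop :=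
  (∀ x, Sim n (a x) (b x)) ∧
  (∀ x, (∑ i, localHeight (x i)) < k → Sim (n+1) (a x) (b x))

noncomputable def lm {m : ℕ} (a b : (Fin m → PP) → PP) : ℝ :=
  (1/2) * sInf {r : ℝ | ∃ n k : ℕ, SimF n k a b ∧ r = (1/2 : ℝ) ^ n + (1/2 : ℝ) ^ (n + k)}

noncomputable def dP2 (p q : PP × PP) : ℝ := max (dP p.1 q.1) (dP p.2 q.2)

def NonExpansive2 (u : PP × PP → PP) : Prop := ∀ p q, dP (u p) (u q) ≤ dP2 p q

def Adequate2 (u : PP × PP → PP) : Prop :=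
  ∀ n π τ, Pmem n π → Pmem n τ → Pmem n (u (π, τ))

def Removing (A : Formula) (u : PP × PP → PP) : Prop :=
  ∀ (Γ Δ : Multiset Formula) (π τ : PP),
    π.Γ = Γ → π.Δ = A ::ₘ Δ → τ.Γ = A ::ₘ Γ → τ.Δ = Δ →
    (u (π, τ)).Γ = Γ ∧ (u (π, τ)).Δ = Δ

def RA (A : Formula) : Type := {u : PP × PP → PP // NonExpansive2 u ∧ Removing A u}

def SimF2 (n k : ℕ) (a b : PP × PP → PP) : Prop :=
  (∀ p, Sim n (a p) (b p)) ∧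
  (∀ p : PP × PP, localHeight p.1 + localHeight p.2 < k → Sim (n+1) (a p) (b p))

noncomputable def l2 (a b : PP × PP → PP) : ℝ :=
  (1/2) * sInf {r : ℝ | ∃ n k : ℕ, SimF2 n k a b ∧ r = (1/2 : ℝ) ^ n + (1/2 : ℝ) ^ (n + k)}

theorem Frag.heq_trunc {c : Bool} {n : ℕ} {Γ Δ Γ' Δ' : Multiset Formula}
    (hΓ : Γ = Γ') (hΔ : Δ = Δ') {a : Frag c (n + 1) Γ Δ} {b : Frag c (n + 1) Γ' Δ'}
    (h : HEq a b) : HEq a.trunc b.trunc := by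
  subst hΓ hΔ
  rw [eq_of_heq h]

namespace Sim

theorem refl (n : ℕ) (x : PP) : Sim n x x := by
  cases n with
  | zero => trivial
  | succ n => exact ⟨rfl, rfl, HEq.rfl⟩

theorem symm {n : ℕ} {x y : PP} (h : Sim n x y) : Sim n y x := by
  cases n with
  | zero => trivial
  | succ n => exact ⟨h.1.symm, h.2.1.symm, h.2.2.symm⟩

theorem trans {n : ℕ} {x y z : PP} (h : Sim n x y) (h' : Sim n y z) : Sim n x z := by
  cases n with
  | zero => trivial
  | succ n => exact ⟨h.1.trans h'.1, h.2.1.trans h'.2.1, h.2.2.trans h'.2.2⟩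

theorem heq_frag {n : ℕ} {x y : PP} (h : Sim (n + 1) x y) :
    HEq (x.prf.frag n) (y.prf.frag n) := by
  rw [← x.prf.compat n, ← y.prf.compat n]
  exact Frag.heq_trunc h.1 h.2.1 h.2.2

theorem of_succ {n : ℕ} {x y : PP} (h : Sim (n + 1) x y) : Sim n x y := by
  cases n with
  | zero => trivial
  | succ n => exact ⟨h.1, h.2.1, h.heq_frag⟩

theorem mono {m n : ℕ} (hmn : m ≤ n) {x y : PP} (h : Sim n x y) : Sim m x y := by
  induction hmn with
  | refl => exact h
  | step _ ih => exact ih h.of_succ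

theorem eq_of_forall {x y : PP} (h : ∀ n, Sim n x y) : x = y := by
  obtain ⟨Γ, Δ, f, hf⟩ := x
  obtain ⟨Γ', Δ', g, hg⟩ := y
  obtain rfl : Γ = Γ' := (h 1).1
  obtain rfl : Δ = Δ' := (h 1).2.1
  obtain rfl : f = g := funext fun n => eq_of_heq (h (n + 1)).heq_frag
  rfl

/-- A sequence whose `k`-th and `(k+1)`-st terms share their `(k+1)`-fragments has a limit. -/
theorem exists_limit (y : ℕ → PP) (hy : ∀ k, Sim (k + 1) (y k) (y (k + 1))) :
    ∃ x, ∀ k, Sim (k + 1) (y k) x := by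
  have hseq : ∀ k, (y k).Γ = (y 0).Γ ∧ (y k).Δ = (y 0).Δ := by
    intro k
    induction k with
    | zero => exact ⟨rfl, rfl⟩
    | succ k ih => exact ⟨(hy k).1.symm.trans ih.1, (hy k).2.1.symm.trans ih.2⟩
  have hfrag : ∀ k, ∃ f : Frag true k (y 0).Γ (y 0).Δ, HEq f ((y k).prf.frag k) := by
    intro k
    rw [← (hseq k).1, ← (hseq k).2]
    exact ⟨_, HEq.rfl⟩
  choose f hf using hfrag
  refine ⟨⟨(y 0).Γ, (y 0).Δ, f, fun n => eq_of_heq ?_⟩, fun k => ⟨(hseq k).1, (hseq k).2, ?_⟩⟩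
  · refine (Frag.heq_trunc (hseq (n + 1)).1.symm (hseq (n + 1)).2.symm (hf (n + 1))).trans ?_
    rw [(y (n + 1)).prf.compat n]
    exact (hy n).heq_frag.symm.trans (hf n).symm
  · exact (hy k).2.2.trans (hf (k + 1)).symm

end Sim

theorem dP_nonneg (x y : PP) : 0 ≤ dP x y := by
  refine Real.sInf_nonneg ?_
  rintro _ ⟨n, -, rfl⟩
  positivity

theorem dP_le_pow {n : ℕ} {x y : PP} (h : Sim n x y) : dP x y ≤ (1 / 2 : ℝ) ^ n := by
  refine csInf_le ⟨0, ?_⟩ ⟨n, h, rfl⟩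
  rintro _ ⟨n, -, rfl⟩
  positivity

theorem dP_eq_zero_of_forall_sim {x y : PP} (h : ∀ n, Sim n x y) : dP x y = 0 :=
  le_antisymm
    (ge_of_tendsto' (tendsto_pow_atTop_nhds_zero_of_lt_one (by norm_num) (by norm_num))
      fun n => dP_le_pow (h n))
    (dP_nonneg x y)

theorem sim_succ_of_dP_lt {n : ℕ} {x y : PP} (h : dP x y < (1 / 2 : ℝ) ^ n) :
    Sim (n + 1) x y := by
  obtain ⟨_, ⟨m, hm, rfl⟩, hlt⟩ := exists_lt_of_csInf_lt
    (s := {r : ℝ | ∃ n : ℕ, Sim n x y ∧ r = (1 / 2 : ℝ) ^ n}) ⟨_, 0, trivial, rfl⟩ h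
  exact hm.mono ((pow_lt_pow_iff_right_of_lt_one₀ (by norm_num) (by norm_num)).1 hlt)

theorem dP_le_iff {x y : PP} {r : ℝ} (hr : 0 ≤ r) :
    dP x y ≤ r ↔ ∀ n : ℕ, r < (1 / 2 : ℝ) ^ n → Sim (n + 1) x y := by
  refine ⟨fun h n hn => sim_succ_of_dP_lt (h.trans_lt hn), fun h => ?_⟩
  by_contra! hlt
  have hall : ∀ n, Sim n x y := by
    intro n
    induction n with
    | zero => trivial
    | succ n ih => exact h n (hlt.trans_le (dP_le_pow ih))
  exact absurd hlt (dP_eq_zero_of_forall_sim hall ▸ hr.not_gt)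

theorem dP_eq_zero_iff (x y : PP) : dP x y = 0 ↔ x = y := by
  refine ⟨fun h => Sim.eq_of_forall fun n => ?_, ?_⟩
  · exact (sim_succ_of_dP_lt (n := n) (h ▸ by positivity)).of_succ
  · rintro rfl
    exact dP_eq_zero_of_forall_sim fun n => Sim.refl n x

theorem dP_comm (x y : PP) : dP x y = dP y x := by
  have h : ∀ n, Sim n x y ↔ Sim n y x := fun n => ⟨Sim.symm, Sim.symm⟩
  simp only [dP, h]

theorem dP_triangle_max (x y z : PP) : dP x z ≤ max (dP x y) (dP y z) := by
  refine (dP_le_iff (le_max_of_le_left (dP_nonneg x y))).2 fun n hn => ?_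
  rw [max_lt_iff] at hn
  exact (sim_succ_of_dP_lt hn.1).trans (sim_succ_of_dP_lt hn.2)

theorem sphericallyComplete_dP : SphericallyComplete dP := by
  intro c r hr hsub
  have hanti : Antitone fun n => cBall dP (c n) (r n) := antitone_nat_of_succ_le hsub
  have hmem : ∀ n m, n ≤ m → dP (c n) (c m) ≤ r n := fun n m hnm => by
    refine hanti hnm (show dP (c m) (c m) ≤ r m from ?_)
    rw [(dP_eq_zero_iff _ _).2 rfl]
    exact hr m
  have hsim : ∀ {n m k : ℕ}, r n < (1 / 2 : ℝ) ^ k → r m < (1 / 2 : ℝ) ^ k →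
      Sim (k + 1) (c n) (c m) := fun {n m k} hn hm =>
    (sim_succ_of_dP_lt ((hmem n _ (le_max_left n m)).trans_lt hn)).trans
      (sim_succ_of_dP_lt ((hmem m _ (le_max_right n m)).trans_lt hm)).symm
  have hpow : ∀ {i j : ℕ}, i ≤ j → (1 / 2 : ℝ) ^ j ≤ (1 / 2 : ℝ) ^ i := fun h =>
    pow_le_pow_of_le_one (by norm_num) (by norm_num) h
  suffices ∃ x, ∀ n k, r n < (1 / 2 : ℝ) ^ k → Sim (k + 1) (c n) x by
    obtain ⟨x, hx⟩ := this
    exact ⟨x, fun n => (dP_le_iff (hr n)).2 (hx n)⟩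
  by_cases hall : ∀ k : ℕ, ∃ n, r n < (1 / 2 : ℝ) ^ k
  · choose N hN using hall
    obtain ⟨x, hx⟩ := Sim.exists_limit (fun k => c (N k)) fun k =>
      hsim (hN k) ((hN (k + 1)).trans_le (hpow k.le_succ))
    exact ⟨x, fun n k hk => (hsim hk (hN k)).trans (hx k)⟩
  · push Not at hall
    classical
    have hlt : ∀ n k, r n < (1 / 2 : ℝ) ^ k → k < Nat.find hall := fun n k hk => by
      by_contra! hle
      exact absurd (hk.trans_le (hpow hle)) (Nat.find_spec hall n).not_gt
    rcases hk₀ : Nat.find hall with _ | j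
    · exact ⟨c 0, fun n k hk => absurd (hk₀ ▸ hlt n k hk) k.not_lt_zero⟩
    · have hj := Nat.find_min hall (m := j) (by omega)
      push Not at hj
      obtain ⟨N, hN⟩ := hj
      refine ⟨c N, fun n k hk => hsim hk (hN.trans_le (hpow ?_))⟩
      have := hlt n k hk
      omega

theorem stmt9 : IsUltrametric dP ∧ SphericallyComplete dP :=
  ⟨⟨dP_nonneg, dP_eq_zero_iff, dP_comm, dP_triangle_max⟩, sphericallyComplete_dP⟩
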